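/- arXiv:0901.1871 — 8 statements merged into one kernel-verified Lean document; each statement's English description precedes it below -/
import Mathlib

section
/- For every target problem (X, ℱ, T, P) on a measurable space (X, 𝒳), every choice of target-algorithm data ((ε_n), (ℱ_n), μ, (P_n)), and every β ∈ (0,1), the discounted distance d(P, P_n) tends to 0 as n → ∞; that is, lim_{n→∞} sup_{x∈X} Σ_{k≥1} β^k |P_n^k(x,T) − P^k(x,T)| = 0. -/
open MeasureTheory Filter Topology

variable {X : Type*}

/-- `σ(f)`: the σ-algebra `{f⁻¹(B) : B ⊆ ℝ Borel}` generated by a real-valued function. -/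
def sigmaOf {X : Type*} (f : X → ℝ) : MeasurableSpace X :=
  MeasurableSpace.comap f Real.measurableSpace

/-- A (measure-valued) transition probability on `(X, ℱ)`: each `P x` is a probability
measure on the sub-σ-algebra `ℱ`, and `x ↦ P x F` is `ℱ`-measurable for `F ∈ ℱ`. -/
noncomputable def IsTransProb {X : Type*} (ℱ : MeasurableSpace X)
    (P : X → @Measure X ℱ) : Prop :=
  (∀ x, IsProbabilityMeasure (P x)) ∧
    ∀ F : Set X, MeasurableSet[ℱ] F → Measurable[ℱ] (fun x => ((P x) F).toReal)

/-- The iterates of a transition probability: `kiter ℱ P k x F = P^{k+1}(x,F)`,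
i.e. `kiter ℱ P 0 = P¹ = P` and `P^{k+1}(x,F) = ∫ P(x,dy) P^k(y,F)`. -/
noncomputable def kiter {X : Type*} (ℱ : MeasurableSpace X) (P : X → @Measure X ℱ) :
    ℕ → X → Set X → ℝ
  | 0, x, F => ((P x) F).toReal
  | (k+1), x, F => MeasureTheory.integral (P x) (fun y => kiter ℱ P k y F)

/-- Assumption (A0): `(X,𝒳)` is a weakly Blackwell space. -/
def WeaklyBlackwell {X : Type*} (𝒳 : MeasurableSpace X) : Prop :=
  ∀ f g : X → ℝ, Measurable[𝒳] f → Measurable[𝒳] g →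
    (∀ x y, f x = f y → g x = g y) → sigmaOf g ≤ sigmaOf f

/-- A compatible projection for the target problem `(X,ℱ,T,P)`: a measurable `f` with
`T ∈ σ(f)`, `σ(f) ⊆ ℱ`, such that `P(x,·)` and `P(y,·)` agree on `σ(f)` whenever
`f x = f y`. -/
def IsCompatibleProjection {X : Type*} (𝒳 ℱ : MeasurableSpace X) (T : Set X)
    (P : X → @Measure X ℱ) (f : X → ℝ) : Prop :=
  Measurable[𝒳] f ∧ MeasurableSet[sigmaOf f] T ∧ sigmaOf f ≤ ℱ ∧
    ∀ x y : X, f x = f y → ∀ F : Set X, MeasurableSet[sigmaOf f] F → (P x) F = (P y) F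

/-- A finite-sum `ℓ¹` bound between the laws of a discrete variable under two probability
measures (on possibly different σ-algebras) bounds the difference of expectations of
functions of that variable taking values in `[-1, 1]`. -/
theorem abs_integral_comp_sub_integral_comp_le {m₁ m₂ : MeasurableSpace X}
    (ν₁ : @Measure X m₁) (ν₂ : @Measure X m₂) (h₁ : IsProbabilityMeasure ν₁)
    (h₂ : IsProbabilityMeasure ν₂) {c : X → ℕ} (hc₁ : Measurable[m₁] c)
    (hc₂ : Measurable[m₂] c) {ε : ℝ}
    (hε : ∀ s : Finset ℕ, ∑ i ∈ s, |(ν₁ (c ⁻¹' {i})).toReal - (ν₂ (c ⁻¹' {i})).toReal| ≤ ε)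
    {φ : ℕ → ℝ} (hφ : ∀ i, |φ i| ≤ 1) :
    |@integral X ℝ _ _ m₁ ν₁ (fun x => φ (c x)) - @integral X ℝ _ _ m₂ ν₂ (fun x => φ (c x))|
      ≤ ε := by
  have key : ∀ (m : MeasurableSpace X) (ν : @Measure X m), IsProbabilityMeasure ν →
      Measurable[m] c → HasSum (fun i => (ν (c ⁻¹' {i})).toReal * φ i)
        (@integral X ℝ _ _ m ν (fun x => φ (c x))) := by
    intro m ν hν hc
    have : IsProbabilityMeasure (ν.map c) := Measure.isProbabilityMeasure_map hc.aemeasurable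
    have hφi : Integrable φ (ν.map c) :=
      Integrable.of_bound (C := 1) (measurable_from_top.aestronglyMeasurable)
        (Eventually.of_forall hφ)
    have h := hasSum_integral_iUnion (μ := ν.map c) (f := φ) (s := fun i : ℕ => {i})
      (fun _ => measurableSet_singleton _)
      (fun i j hij => by simpa [Function.onFun] using hij) hφi.integrableOn
    have hU : (⋃ i : ℕ, ({i} : Set ℕ)) = Set.univ := by ext; simp
    rw [hU, Measure.restrict_univ,
      integral_map hc.aemeasurable measurable_from_top.aestronglyMeasurable] at h
    simpa only [integral_singleton, measureReal_def,
      Measure.map_apply hc (measurableSet_singleton _), smul_eq_mul] using h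
  have h := ((key m₁ ν₁ h₁ hc₁).sub (key m₂ ν₂ h₂ hc₂)).norm
  refine le_of_tendsto' h fun s => ?_
  refine (norm_sum_le _ _).trans (le_trans (Finset.sum_le_sum fun i _ => ?_) (hε s))
  rw [← sub_mul, Real.norm_eq_abs, abs_mul]
  exact mul_le_of_le_one_right (abs_nonneg _) (hφ i)

/-- Perturbed version of `abs_integral_comp_sub_integral_comp_le` for a function with
oscillation at most `δ` on the fibres of `c`. -/
theorem abs_integral_sub_integral_le_of_osc {m₁ m₂ : MeasurableSpace X}
    (ν₁ : @Measure X m₁) (ν₂ : @Measure X m₂) (h₁ : IsProbabilityMeasure ν₁)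
    (h₂ : IsProbabilityMeasure ν₂) {c : X → ℕ} (hc₁ : Measurable[m₁] c)
    (hc₂ : Measurable[m₂] c) {ε δ e : ℝ}
    (hε : ∀ s : Finset ℕ, ∑ i ∈ s, |(ν₁ (c ⁻¹' {i})).toReal - (ν₂ (c ⁻¹' {i})).toReal| ≤ ε)
    {f g : X → ℝ} (hf : Integrable f ν₁) (hg : Integrable g ν₂)
    (hg1 : ∀ x, |g x| ≤ 1) (hosc : ∀ x y, c x = c y → |g x - g y| ≤ δ)
    (hfg : ∀ x, |f x - g x| ≤ e) :
    |@integral X ℝ _ _ m₁ ν₁ f - @integral X ℝ _ _ m₂ ν₂ g| ≤ ε + e + 2 * δ := by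
  classical
  obtain ⟨φ, hφ, hgφ⟩ : ∃ φ : ℕ → ℝ, (∀ i, |φ i| ≤ 1) ∧ ∀ x, |g x - φ (c x)| ≤ δ := by
    refine ⟨fun i => if h : ∃ z, c z = i then g h.choose else 0, fun i => ?_, fun x => ?_⟩
    · dsimp only
      split_ifs
      · exact hg1 _
      · simp
    · have h : ∃ z, c z = c x := ⟨x, rfl⟩
      simp only [dif_pos h]
      exact hosc _ _ h.choose_spec.symm
  have key : ∀ (m : MeasurableSpace X) (ν : @Measure X m) (u : X → ℝ) (a : ℝ),
      IsProbabilityMeasure ν → Measurable[m] c → Integrable u ν →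
      (∀ x, |u x - φ (c x)| ≤ a) →
      |@integral X ℝ _ _ m ν u - @integral X ℝ _ _ m ν (fun x => φ (c x))| ≤ a := by
    intro m ν u a hν hc hu hua
    have hφi : Integrable (fun x => φ (c x)) ν :=
      Integrable.of_bound (C := 1) ((measurable_from_top.comp hc).aestronglyMeasurable)
        (Eventually.of_forall fun x => hφ (c x))
    rw [← integral_sub hu hφi]
    simpa using norm_integral_le_of_norm_le_const (μ := ν) (f := fun x => u x - φ (c x)) (C := a)
      (Eventually.of_forall hua)
  have k₁ := key m₁ ν₁ f (e + δ) h₁ hc₁ hf fun x =>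
    (abs_sub_le _ (g x) _).trans (add_le_add (hfg x) (hgφ x))
  have k₂ := key m₂ ν₂ g δ h₂ hc₂ hg hgφ
  have k₃ := abs_integral_comp_sub_integral_comp_le ν₁ ν₂ h₁ h₂ hc₁ hc₂ hε hφ
  rw [abs_le] at *
  constructor <;> linarith [k₁.1, k₁.2, k₂.1, k₂.2, k₃.1, k₃.2]

namespace IsTransProb

theorem measurable {ℱ : MeasurableSpace X} {P : X → Measure X} (hP : IsTransProb ℱ P) :
    Measurable P := by
  have := hP.1
  refine Measure.measurable_of_measurable_coe _ fun F hF => ?_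
  simpa using (hP.2 F hF).ennreal_ofReal

theorem measurable_integral {ℱ : MeasurableSpace X} {P : X → Measure X}
    (hP : IsTransProb ℱ P) {f : X → ℝ} (hf : Measurable f) :
    Measurable fun x => ∫ y, f y ∂(P x) := by
  have := hP.1
  let κ : ProbabilityTheory.Kernel X X := ⟨P, hP.measurable⟩
  have : ProbabilityTheory.IsMarkovKernel κ := ⟨hP.1⟩
  exact (hf.stronglyMeasurable.integral_kernel (κ := κ)).measurable

theorem abs_integral_le_one {ℱ : MeasurableSpace X} {P : X → Measure X}
    (hP : IsTransProb ℱ P) {f : X → ℝ} (hf : ∀ x, |f x| ≤ 1) (x : X) :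
    |∫ y, f y ∂(P x)| ≤ 1 := by
  have := hP.1 x
  simpa using norm_integral_le_of_norm_le_const (μ := P x) (f := f) (C := 1)
    (Eventually.of_forall hf)

theorem integrable {ℱ : MeasurableSpace X} {P : X → Measure X} (hP : IsTransProb ℱ P)
    {f : X → ℝ} (hf : Measurable f) (hf1 : ∀ x, |f x| ≤ 1) (x : X) : Integrable f (P x) := by
  have := hP.1 x
  exact Integrable.of_bound (C := 1) hf.aestronglyMeasurable (Eventually.of_forall hf1)

theorem kiter_zero {ℱ : MeasurableSpace X} (P : X → Measure X) {T : Set X}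
    (hT : MeasurableSet T) (x : X) :
    kiter ℱ P 0 x T = ∫ y, T.indicator 1 y ∂(P x) := by
  rw [integral_indicator_one hT]; rfl

theorem measurable_kiter {ℱ : MeasurableSpace X} {P : X → Measure X} (hP : IsTransProb ℱ P)
    {T : Set X} (hT : MeasurableSet T) (k : ℕ) : Measurable fun x => kiter ℱ P k x T := by
  induction k with
  | zero => exact hP.2 T hT
  | succ k ih => exact hP.measurable_integral ih

theorem abs_kiter_le_one {ℱ : MeasurableSpace X} {P : X → Measure X} (hP : IsTransProb ℱ P)
    {T : Set X} (k : ℕ) (x : X) : |kiter ℱ P k x T| ≤ 1 := by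
  induction k generalizing x with
  | zero =>
    have := hP.1 x
    rw [kiter, abs_of_nonneg ENNReal.toReal_nonneg]
    exact measureReal_le_one (μ := P x)
  | succ k ih => exact hP.abs_integral_le_one ih x

/-- The differences of the masses of disjoint sets under two rows are summable. -/
theorem summable_abs_sub {ℱ : MeasurableSpace X} {P : X → Measure X} (hP : IsTransProb ℱ P)
    {c : X → ℕ} (hc : Measurable c) (x y : X) :
    Summable fun i : ℕ => |((P x) (c ⁻¹' {i})).toReal - ((P y) (c ⁻¹' {i})).toReal| := by
  have key : ∀ z, Summable fun i : ℕ => ((P z) (c ⁻¹' {i})).toReal := fun z => by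
    have := hP.1 z
    refine ENNReal.summable_toReal ?_
    rw [← measure_iUnion (fun i j hij => Disjoint.preimage c (by simpa using hij))
      fun i => hc (measurableSet_singleton i)]
    exact measure_ne_top _ _
  exact ((key x).sub (key y)).abs

end IsTransProb

/-- A function whose oscillation on the fibres of `c m` tends to `0` is measurable for any
σ-algebra making all the `c m` measurable. -/
theorem measurable_of_eventually_osc_le {m₀ : MeasurableSpace X} {c : ℕ → X → ℕ}
    (hc : ∀ m, Measurable (c m)) {f : X → ℝ}
    (hf : ∀ η > 0, ∀ᶠ m in atTop, ∀ x y, c m x = c m y → |f x - f y| ≤ η) :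
    Measurable f := by
  classical
  let φ : ℕ → ℕ → ℝ := fun m i => if h : ∃ z, c m z = i then f h.choose else 0
  refine measurable_of_tendsto_metrizable (f := fun m x => φ m (c m x))
    (fun m => (measurable_from_top (f := φ m)).comp (hc m)) (tendsto_pi_nhds.2 fun x => ?_)
  rw [Metric.tendsto_nhds]
  intro η hη
  filter_upwards [hf (η / 2) (half_pos hη)] with m hm
  have h : ∃ z, c m z = c m x := ⟨x, rfl⟩
  simp only [φ, dif_pos h, Real.dist_eq]
  exact (hm _ _ h.choose_spec).trans_lt (half_lt_self hη)

/-- **Theorem (main approximation theorem).**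
For every target problem `(X, ℱ, T, P)`, every choice of target-algorithm data
`((ε_n), (ℱ_n) (with cells given by the fibers of c_n), μ, (P_n))`, and every `β ∈ (0,1)`,
the discounted distance `d(P, P_n) = sup_x Σ_{k≥1} β^k |P_n^k(x,T) − P^k(x,T)|`
tends to `0` as `n → ∞`. -/
theorem target_algorithm_tendsto_zero
    -- the target problem (X, ℱ, T, P) on the measurable space (X, 𝒳)
    (𝒳 ℱ : MeasurableSpace X) (hℱ𝒳 : ℱ ≤ 𝒳)
    (T : Set X) (hT : MeasurableSet[ℱ] T)
    (P : X → @Measure X ℱ) (hP : IsTransProb ℱ P)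
    -- (ε_n)_{n≥1}: positive reals strictly decreasing to 0
    (ε : ℕ → ℝ) (hεpos : ∀ n, 0 < ε n) (hεanti : StrictAnti ε)
    (hεlim : Tendsto ε atTop (𝓝 0))
    -- (ℱ_n): increasing sub-σ-algebras of ℱ, each generated by the countable
    -- partition of X into the fibers of c n, with ℱ_0 = σ({T})
    (ℱn : ℕ → MeasurableSpace X) (c : ℕ → X → ℕ)
    (hmono : Monotone ℱn) (hle : ∀ n, ℱn n ≤ ℱ)
    (h0 : ℱn 0 = MeasurableSpace.generateFrom {T})
    (hgen : ∀ n, ℱn n = MeasurableSpace.comap (c n) ⊤)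
    -- points in the same cell of the ℱ_{n+1}-partition have ε_{n+1}-close rows
    -- with respect to the ℱ_n-partition
    (happrox : ∀ (n : ℕ) (x y : X), c (n+1) x = c (n+1) y →
      (∑' i : ℕ, |((P x) (c n ⁻¹' {i})).toReal - ((P y) (c n ⁻¹' {i})).toReal|) ≤ ε (n+1))
    -- μ: a probability measure on ⋁_n ℱ_n, positive on nonempty sets of ⋃_n ℱ_n
    (μ : @Measure X (⨆ n, ℱn n)) (hμ : IsProbabilityMeasure μ)
    (hμpos : ∀ (n : ℕ) (F : Set X), MeasurableSet[ℱn n] F → F.Nonempty → 0 < μ F)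
    -- (P_n): transition probabilities on (X, ℱ_n), given by the μ-average of P over cells
    (Pn : ∀ n : ℕ, X → @Measure X (ℱn n))
    (hPn : ∀ n, IsTransProb (ℱn n) (Pn n))
    (hPndef : ∀ (n : ℕ) (x : X) (F : Set X), MeasurableSet[ℱn n] F →
      ((Pn n x) F).toReal =
        (∫ z in c n ⁻¹' {c n x}, ((P z) F).toReal ∂μ) / (μ (c n ⁻¹' {c n x})).toReal)
    -- the discount rate β ∈ (0,1)
    (β : ℝ) (hβ0 : 0 < β) (hβ1 : β < 1) :
    Tendsto
      (fun n => ⨆ x : X,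
        ∑' k : ℕ, β ^ (k + 1) * |kiter (ℱn n) (Pn n) k x T - kiter ℱ P k x T|)
      atTop (𝓝 0) := by
  classical
  have hcm : ∀ n, Measurable[ℱn n] (c n) := fun n => by
    rw [hgen n]; exact comap_measurable (c n)
  have hcm' : ∀ n, Measurable[ℱn (n + 1)] (c n) := fun n =>
    (hcm n).mono (hmono n.le_succ) le_rfl
  have hcℱ : ∀ n, Measurable[ℱ] (c n) := fun n => (hcm n).mono (hle n) le_rfl
  have hcsup : ∀ n, Measurable[⨆ n, ℱn n] (c n) := fun n =>
    (hcm n).mono (le_iSup ℱn n) le_rfl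
  have hTn : ∀ n, MeasurableSet[ℱn n] T := fun n => hmono n.zero_le _ <| by
    rw [h0]; exact MeasurableSpace.measurableSet_generateFrom rfl
  have hrow : ∀ n x y, c (n + 1) x = c (n + 1) y → ∀ s : Finset ℕ,
      ∑ i ∈ s, |((P x) (c n ⁻¹' {i})).toReal - ((P y) (c n ⁻¹' {i})).toReal| ≤ ε (n + 1) :=
    fun n x y hxy s => ((hP.summable_abs_sub (hcℱ n) x y).sum_le_tsum s
      fun _ _ => abs_nonneg _).trans (happrox n x y hxy)
  have hεev : ∀ η > 0, ∀ᶠ n in atTop, ε (n + 1) ≤ η := fun η hη =>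
    ((tendsto_add_atTop_iff_nat 1).2 hεlim).eventually_le_const hη
  have hshift : ∀ p : ℕ → Prop, (∀ᶠ n in atTop, p (n + 1)) → ∀ᶠ n in atTop, p n := by
    intro p hp
    rw [← map_add_atTop_eq_nat 1]
    exact hp
  -- integrating against `P` preserves asymptotic constancy on cells
  have hosc_step : ∀ f : X → ℝ, Measurable[ℱ] f → (∀ x, |f x| ≤ 1) →
      (∀ η > 0, ∀ᶠ m in atTop, ∀ x y, c m x = c m y → |f x - f y| ≤ η) →
      ∀ η > 0, ∀ᶠ m in atTop, ∀ x y, c m x = c m y →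
        |@integral X ℝ _ _ ℱ (P x) f - @integral X ℝ _ _ ℱ (P y) f| ≤ η := by
    intro f hf hf1 hosc η hη
    refine hshift _ ?_
    filter_upwards [hosc (η / 4) (by positivity), hεev (η / 2) (by positivity)]
      with m hm hεm x y hxy
    have := abs_integral_sub_integral_le_of_osc (P x) (P y) (hP.1 x) (hP.1 y) (hcℱ m) (hcℱ m)
      (hrow m x y hxy) (hP.integrable hf hf1 x) (hP.integrable hf hf1 y) hf1 hm
      (e := 0) (f := f) (fun x => by simp)
    linarith
  have hosc_ind : ∀ F : Set X, ∀ n, MeasurableSet[ℱn n] F →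
      ∀ η > 0, ∀ᶠ m in atTop, ∀ x y, c m x = c m y →
        |F.indicator (1 : X → ℝ) x - F.indicator (1 : X → ℝ) y| ≤ η := by
    intro F n hF η hη
    filter_upwards [eventually_ge_atTop n] with m hm x y hxy
    have hFm := hmono hm _ hF
    rw [hgen m] at hFm
    obtain ⟨S, -, rfl⟩ := hFm
    simp only [Set.indicator, Set.mem_preimage, hxy, Pi.one_apply, sub_self, abs_zero]
    exact hη.le
  have hind1 : ∀ (F : Set X) (x : X), |F.indicator (1 : X → ℝ) x| ≤ 1 := fun F x => by
    by_cases hx : x ∈ F <;> simp [hx]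
  have hindm : ∀ (m : MeasurableSpace X) (F : Set X), MeasurableSet[m] F →
      Measurable[m] (F.indicator (1 : X → ℝ)) := fun m F hF => measurable_one.indicator hF
  have hosc : ∀ k, ∀ η > 0, ∀ᶠ m in atTop, ∀ x y, c m x = c m y →
      |kiter ℱ P k x T - kiter ℱ P k y T| ≤ η := by
    intro k
    induction k with
    | zero =>
      simp only [IsTransProb.kiter_zero P hT]
      exact hosc_step _ (hindm ℱ T hT) (hind1 T) (hosc_ind T 0 (hTn 0))
    | succ k ih =>
      exact hosc_step _ (hP.measurable_kiter hT k) (hP.abs_kiter_le_one k) ih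
  -- rows of `P` are measurable for the σ-algebra carrying `μ`
  have hPmeas : ∀ n F, MeasurableSet[ℱn n] F →
      Measurable[⨆ n, ℱn n] fun z => ((P z) F).toReal := by
    intro n F hF
    refine measurable_of_eventually_osc_le hcsup ?_
    have hFℱ := hle n _ hF
    simpa only [integral_indicator_one hFℱ, measureReal_def] using
      hosc_step _ (hindm ℱ F hFℱ) (hind1 F) (hosc_ind F n hF)
  -- averaging keeps the rows close
  have hrow' : ∀ n x, ∀ s : Finset ℕ,
      ∑ i ∈ s, |((Pn (n + 1) x) (c n ⁻¹' {i})).toReal - ((P x) (c n ⁻¹' {i})).toReal|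
        ≤ ε (n + 1) := by
    intro n x s
    set C := c (n + 1) ⁻¹' {c (n + 1) x} with hC
    have hCm : MeasurableSet[ℱn (n + 1)] C := hcm (n + 1) (measurableSet_singleton _)
    have hCm' : MeasurableSet[⨆ n, ℱn n] C := hcsup (n + 1) (measurableSet_singleton _)
    have hCpos : 0 < (μ C).toReal :=
      ENNReal.toReal_pos (hμpos _ C hCm ⟨x, rfl⟩).ne' (measure_ne_top _ _)
    have hAm : ∀ i, MeasurableSet[ℱn (n + 1)] (c n ⁻¹' {i}) := fun i =>
      hcm' n (measurableSet_singleton _)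
    have hint : ∀ i, IntegrableOn (fun z => ((P z) (c n ⁻¹' {i})).toReal) C μ := fun i =>
      Integrable.of_bound (C := 1) (hPmeas _ _ (hAm i)).aestronglyMeasurable
        (Eventually.of_forall fun z => by
          rw [Real.norm_eq_abs]; exact hP.abs_kiter_le_one 0 z)
    have hterm : ∀ i, |((Pn (n + 1) x) (c n ⁻¹' {i})).toReal - ((P x) (c n ⁻¹' {i})).toReal|
        ≤ (∫ z in C, |((P z) (c n ⁻¹' {i})).toReal - ((P x) (c n ⁻¹' {i})).toReal| ∂μ)
          / (μ C).toReal := by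
      intro i
      rw [hPndef _ _ _ (hAm i), ← hC, le_div_iff₀ hCpos]
      nth_rewrite 2 [← abs_of_pos hCpos]
      rw [← abs_mul, sub_mul, div_mul_cancel₀ _ hCpos.ne']
      have : ((P x) (c n ⁻¹' {i})).toReal * (μ C).toReal
          = ∫ z in C, ((P x) (c n ⁻¹' {i})).toReal ∂μ := by
        rw [setIntegral_const, smul_eq_mul, mul_comm, measureReal_def]
      rw [this, ← integral_sub (hint i) (integrable_const _)]
      exact abs_integral_le_integral_abs
    refine (Finset.sum_le_sum fun i _ => hterm i).trans ?_
    have hint' : ∀ i, IntegrableOn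
        (fun z => |((P z) (c n ⁻¹' {i})).toReal - ((P x) (c n ⁻¹' {i})).toReal|) C μ :=
      fun i => ((hint i).sub (integrable_const _)).abs
    rw [← Finset.sum_div, ← integral_finsetSum s (fun i _ => hint' i), div_le_iff₀ hCpos]
    refine (setIntegral_mono_on (integrable_finsetSum s fun i _ => hint' i)
      (integrable_const (ε (n + 1))) hCm' fun z hz => hrow n z x hz s).trans ?_
    rw [setIntegral_const, smul_eq_mul, mul_comm, measureReal_def]
  have hconv_step : ∀ (f : X → ℝ) (g : ℕ → X → ℝ), Measurable[ℱ] f → (∀ x, |f x| ≤ 1) →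
      (∀ n, Measurable[ℱn n] (g n)) → (∀ n x, |g n x| ≤ 1) →
      (∀ η > 0, ∀ᶠ m in atTop, ∀ x y, c m x = c m y → |f x - f y| ≤ η) →
      (∀ η > 0, ∀ᶠ n in atTop, ∀ x, |g n x - f x| ≤ η) →
      ∀ η > 0, ∀ᶠ n in atTop, ∀ x,
        |@integral X ℝ _ _ (ℱn n) (Pn n x) (g n) - @integral X ℝ _ _ ℱ (P x) f| ≤ η := by
    intro f g hf hf1 hg hg1 hfosc hgf η hη
    refine hshift _ ?_
    filter_upwards [hfosc (η / 6) (by positivity), hεev (η / 3) (by positivity),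
      (tendsto_add_atTop_nat 1).eventually (hgf (η / 3) (by positivity))] with n hn hεn hgn x
    have := abs_integral_sub_integral_le_of_osc (Pn (n + 1) x) (P x) ((hPn _).1 x) (hP.1 x)
      (hcm' n) (hcℱ n) (hrow' n x) ((hPn _).integrable (hg (n + 1)) (hg1 _) x)
      (hP.integrable hf hf1 x) hf1 hn hgn
    linarith
  have hconv : ∀ k, ∀ η > 0, ∀ᶠ n in atTop, ∀ x,
      |kiter (ℱn n) (Pn n) k x T - kiter ℱ P k x T| ≤ η := by
    intro k
    induction k with
    | zero =>
      simp only [IsTransProb.kiter_zero P hT, IsTransProb.kiter_zero (Pn _) (hTn _)]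
      exact hconv_step _ (fun _ => T.indicator 1) (hindm ℱ T hT) (hind1 T)
        (fun n => hindm _ T (hTn n)) (fun _ => hind1 T) (hosc_ind T 0 (hTn 0))
        (fun η hη => Eventually.of_forall fun n x => by simpa using hη.le)
    | succ k ih =>
      exact hconv_step _ (fun n x => kiter (ℱn n) (Pn n) k x T) (hP.measurable_kiter hT k)
        (hP.abs_kiter_le_one k) (fun n => (hPn n).measurable_kiter (hTn n) k)
        (fun n => (hPn n).abs_kiter_le_one k) (hosc k) ih
  -- dominated convergence for the discounted series
  have hdiff : ∀ n k x, |kiter (ℱn n) (Pn n) k x T - kiter ℱ P k x T| ≤ 2 := fun n k x => by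
    have h₁ := (hPn n).abs_kiter_le_one (T := T) k x
    have h₂ := hP.abs_kiter_le_one (T := T) k x
    linarith [abs_sub (kiter (ℱn n) (Pn n) k x T) (kiter ℱ P k x T)]
  let e : ℕ → ℕ → ℝ := fun n k => ⨆ x, |kiter (ℱn n) (Pn n) k x T - kiter ℱ P k x T|
  have he0 : ∀ n k, 0 ≤ e n k := fun n k => Real.iSup_nonneg fun x => abs_nonneg _
  have he2 : ∀ n k, e n k ≤ 2 := fun n k => Real.iSup_le (hdiff n k) (by norm_num)
  have hle_e : ∀ n k x, |kiter (ℱn n) (Pn n) k x T - kiter ℱ P k x T| ≤ e n k :=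
    fun n k x => le_ciSup (f := fun x => |kiter (ℱn n) (Pn n) k x T - kiter ℱ P k x T|)
      ⟨2, Set.forall_mem_range.2 (hdiff n k)⟩ x
  have he : ∀ k, Tendsto (fun n => e n k) atTop (𝓝 0) := by
    intro k
    rw [Metric.tendsto_nhds]
    intro η hη
    filter_upwards [hconv k (η / 2) (half_pos hη)] with n hn
    rw [Real.dist_0_eq_abs, abs_of_nonneg (he0 n k)]
    exact (Real.iSup_le hn (half_pos hη).le).trans_lt (half_lt_self hη)
  have hβs : Summable fun k : ℕ => β ^ (k + 1) * 2 :=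
    ((summable_nat_add_iff 1).2 (summable_geometric_of_lt_one hβ0.le hβ1)).mul_right 2
  have hsum : ∀ u : ℕ → ℝ, (∀ k, 0 ≤ u k) → (∀ k, u k ≤ 2) →
      Summable fun k => β ^ (k + 1) * u k := fun u hu0 hu2 =>
    Summable.of_nonneg_of_le (fun k => mul_nonneg (by positivity) (hu0 k))
      (fun k => mul_le_mul_of_nonneg_left (hu2 k) (by positivity)) hβs
  have hlim : Tendsto (fun n => ∑' k, β ^ (k + 1) * e n k) atTop (𝓝 0) := by
    have := tendsto_tsum_of_dominated_convergence (f := fun n k => β ^ (k + 1) * e n k)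
      (g := fun _ => (0 : ℝ)) (𝓕 := atTop) hβs
      (fun k => by simpa using (he k).const_mul (β ^ (k + 1)))
      (Eventually.of_forall fun n k => by
        rw [Real.norm_of_nonneg (mul_nonneg (by positivity) (he0 n k))]
        exact mul_le_mul_of_nonneg_left (he2 n k) (by positivity))
    simpa using this
  refine squeeze_zero (fun n => Real.iSup_nonneg fun x => tsum_nonneg fun k =>
    mul_nonneg (by positivity) (abs_nonneg _)) (fun n => ?_) hlim
  refine Real.iSup_le (fun x => ?_) (tsum_nonneg fun k => mul_nonneg (by positivity) (he0 n k))
  exact (hsum _ (fun k => abs_nonneg _) fun k => hdiff n k x).tsum_le_tsum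
    (fun k => mul_le_mul_of_nonneg_left (hle_e n k x) (by positivity))
    (hsum _ (he0 n) (he2 n))
end

section
/- Let (X, 𝒳) be a weakly Blackwell measurable space, (X, ℱ, T, P) a target problem, and π_f a compatible projection for it. Then for every F ∈ σ(f) the map x ↦ P(x,F) is σ(f)-measurable; consequently the restriction of P to X × σ(f) is a transition probability on (X, σ(f)), so that (X, σ(f), T, P|_{X × σ(f)}) is again a target problem. -/
open MeasureTheory Filter Topology

variable {X : Type*}

/-- **Theorem.** On a weakly Blackwell space, if `π_f` is a compatible projection for the
target problem `(X, ℱ, T, P)`, then for every `F ∈ σ(f)` the map `x ↦ P(x,F)` is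
`σ(f)`-measurable; consequently the restriction of `P` to `X × σ(f)` is a transition
probability on `(X, σ(f))`, so `(X, σ(f), T, P|)` is again a target problem. -/
theorem compatible_projection_gives_target_problem
    (𝒳 ℱ : MeasurableSpace X) (hBW : WeaklyBlackwell 𝒳) (hℱ𝒳 : ℱ ≤ 𝒳)
    (T : Set X) (hT : MeasurableSet[ℱ] T)
    (P : X → @Measure X ℱ) (hP : IsTransProb ℱ P)
    (f : X → ℝ) (hf : IsCompatibleProjection 𝒳 ℱ T P f) :
    (∀ F : Set X, MeasurableSet[sigmaOf f] F →
        Measurable[sigmaOf f] (fun x => ((P x) F).toReal)) ∧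
      ∃ Pπ : X → @Measure X (sigmaOf f), IsTransProb (sigmaOf f) Pπ ∧
        ∀ (x : X) (F : Set X), MeasurableSet[sigmaOf f] F → (Pπ x) F = (P x) F := by
  obtain ⟨hP1, hPm⟩ := hP
  obtain ⟨hf𝒳, -, hfℱ, hcompat⟩ := hf
  have hmeas : ∀ F : Set X, MeasurableSet[sigmaOf f] F →
      Measurable[sigmaOf f] (fun x => ((P x) F).toReal) := by
    intro F hF
    have hg : Measurable[𝒳] (fun x => ((P x) F).toReal) :=
      (hPm F (hfℱ F hF)).mono hℱ𝒳 le_rfl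
    exact measurable_iff_comap_le.mpr
      (hBW f _ hf𝒳 hg fun x y hxy => congrArg ENNReal.toReal (hcompat x y hxy F hF))
  have htrim : ∀ (x : X) (F : Set X), MeasurableSet[sigmaOf f] F →
      ((P x).trim hfℱ) F = (P x) F := fun x F hF => trim_measurableSet_eq hfℱ hF
  refine ⟨hmeas, fun x => (P x).trim hfℱ, ⟨fun x => ?_, fun F hF => ?_⟩, htrim⟩
  · exact ⟨(htrim x _ MeasurableSet.univ).trans (hP1 x).measure_univ⟩
  · simpa only [htrim _ F hF] using hmeas F hF
end

section
/- Let (X, 𝒳) be a weakly Blackwell measurable space and (X, ℱ, T, P) a target problem. Then there exists a compatible projection π_f for (X, ℱ, T, P) that is optimal, i.e., for every compatible projection π_g and all x, y ∈ X, g(x) = g(y) implies f(x) = f(y). Moreover the optimal compatible projection is unique as an equivalence relation: any two optimal compatible projections π_{f₁}, π_{f₂} satisfy (f₁(x) = f₁(y) ⟺ f₂(x) = f₂(y)) for all x, y. -/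
open MeasureTheory Filter Topology

variable {X : Type*}

/-- The `n`-th stage in closing `{T}` under intersections and under the superlevel sets
`{x | q < P x A}` at rational levels `q`. -/
def refinementStage {X : Type*} {ℱ : MeasurableSpace X} (T : Set X) (P : X → @Measure X ℱ) :
    ℕ → Set (Set X)
  | 0 => {T}
  | n + 1 => refinementStage T P n ∪
      (Set.image2 (· ∩ ·) (refinementStage T P n) (refinementStage T P n) ∪
        Set.image2 (fun (q : ℚ) A => {x | (q : ℝ) < ((P x) A).toReal}) Set.univ
          (refinementStage T P n))

/-- The closure of `{T}` under intersections and under the superlevel sets `{x | q < P x A}`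
at rational levels `q`. -/
def refinement {X : Type*} {ℱ : MeasurableSpace X} (T : Set X) (P : X → @Measure X ℱ) :
    Set (Set X) :=
  ⋃ n, refinementStage T P n

section Refinement

variable {X : Type*} {ℱ : MeasurableSpace X} {T : Set X} {P : X → @Measure X ℱ}

theorem monotone_refinementStage : Monotone (refinementStage T P) :=
  monotone_nat_of_le_succ fun _ => Set.subset_union_left

theorem countable_refinement : (refinement T P).Countable := by
  refine Set.countable_iUnion fun n => ?_
  induction n with
  | zero => exact Set.countable_singleton T
  | succ n ih => exact ih.union ((ih.image2 ih _).union (Set.countable_univ.image2 ih _))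

theorem self_mem_refinement : T ∈ refinement T P :=
  Set.mem_iUnion.2 ⟨0, rfl⟩

theorem inter_mem_refinement {A B : Set X} (hA : A ∈ refinement T P)
    (hB : B ∈ refinement T P) : A ∩ B ∈ refinement T P := by
  obtain ⟨m, hm⟩ := Set.mem_iUnion.1 hA
  obtain ⟨n, hn⟩ := Set.mem_iUnion.1 hB
  exact Set.mem_iUnion.2 ⟨max m n + 1, Or.inr (Or.inl
    ⟨A, monotone_refinementStage (le_max_left m n) hm,
      B, monotone_refinementStage (le_max_right m n) hn, rfl⟩)⟩

theorem superlevel_mem_refinement {A : Set X} (hA : A ∈ refinement T P) (q : ℚ) :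
    {x | (q : ℝ) < ((P x) A).toReal} ∈ refinement T P := by
  obtain ⟨n, hn⟩ := Set.mem_iUnion.1 hA
  exact Set.mem_iUnion.2 ⟨n + 1, Or.inr (Or.inr ⟨q, Set.mem_univ q, A, hn, rfl⟩)⟩

/-- A σ-algebra containing `T` and closed under taking superlevel sets of `P · A` contains the
whole refinement. -/
theorem measurableSet_of_mem_refinement {m : MeasurableSpace X} (hT : MeasurableSet[m] T)
    (hm : ∀ A, MeasurableSet[m] A → ∀ q : ℚ, MeasurableSet[m] {x | (q : ℝ) < ((P x) A).toReal})
    {A : Set X} (hA : A ∈ refinement T P) : MeasurableSet[m] A := by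
  obtain ⟨n, hn⟩ := Set.mem_iUnion.1 hA
  clear hA
  induction n generalizing A with
  | zero => exact hn ▸ hT
  | succ n ih =>
    rcases hn with hn | ⟨B, hB, C, hC, rfl⟩ | ⟨q, -, B, hB, rfl⟩
    · exact ih hn
    · exact (ih hB).inter (ih hC)
    · exact hm B (ih hB) q

theorem measure_eq_of_forall_mem_refinement_iff (hP : ∀ x, IsProbabilityMeasure (P x)) {x y : X}
    (hxy : ∀ A ∈ refinement T P, x ∈ A ↔ y ∈ A) {A : Set X} (hA : A ∈ refinement T P) :
    (P x) A = (P y) A := by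
  have := hP x
  have := hP y
  rw [← ENNReal.toReal_eq_toReal_iff' (measure_ne_top _ _) (measure_ne_top _ _)]
  have key (q : ℚ) : (q : ℝ) < ((P x) A).toReal ↔ (q : ℝ) < ((P y) A).toReal :=
    hxy _ (superlevel_mem_refinement hA q)
  exact le_antisymm (le_of_forall_rat_lt_imp_le fun q hq => ((key q).1 hq).le)
    (le_of_forall_rat_lt_imp_le fun q hq => ((key q).2 hq).le)

end Refinement

/-- A countable family of sets is encoded by a single real function: it separates exactly the
points separated by the family, and generates the same σ-algebra. -/
theorem Set.Countable.exists_real_generator {X : Type*} {C : Set (Set X)} (hC : C.Countable) :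
    ∃ f : X → ℝ, (∀ x y, f x = f y ↔ ∀ A ∈ C, x ∈ A ↔ y ∈ A) ∧
      sigmaOf f = MeasurableSpace.generateFrom C := by
  classical
  have := hC.to_subtype
  let code : X → C → Bool := fun x A => decide (x ∈ A.1)
  have hemb := measurableEmbedding_embeddingReal (C → Bool)
  refine ⟨fun x => embeddingReal (C → Bool) (code x), fun x y => ?_, le_antisymm ?_ ?_⟩
  · rw [hemb.injective.eq_iff]
    simp [code, funext_iff]
  · refine Measurable.comap_le (hemb.measurable.comp ?_)
    refine @measurable_pi_lambda _ _ _ (_) _ _ fun A => ?_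
    refine @measurable_to_bool _ (_) _ ?_
    have : (fun x => code x A) ⁻¹' {true} = A.1 := by ext; simp [code]
    rw [this]
    exact MeasurableSpace.measurableSet_generateFrom A.2
  · refine MeasurableSpace.generateFrom_le fun A hA => ?_
    refine ⟨_, hemb.measurableSet_image.2
      (measurable_pi_apply (⟨A, hA⟩ : C) (MeasurableSet.singleton true)), ?_⟩
    ext x
    simp [code, hemb.injective.eq_iff]

/-- **Theorem.** On a weakly Blackwell space, every target problem `(X, ℱ, T, P)` admits an
optimal compatible projection (one which is coarser than every other compatible
projection), and the optimal compatible projection is unique as an equivalence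
relation. -/
theorem exists_unique_optimal_compatible_projection
    (𝒳 ℱ : MeasurableSpace X) (hBW : WeaklyBlackwell 𝒳) (hℱ𝒳 : ℱ ≤ 𝒳)
    (T : Set X) (hT : MeasurableSet[ℱ] T)
    (P : X → @Measure X ℱ) (hP : IsTransProb ℱ P) :
    (∃ f : X → ℝ, IsCompatibleProjection 𝒳 ℱ T P f ∧
        ∀ g : X → ℝ, IsCompatibleProjection 𝒳 ℱ T P g →
          ∀ x y : X, g x = g y → f x = f y) ∧
      ∀ f₁ f₂ : X → ℝ,
        IsCompatibleProjection 𝒳 ℱ T P f₁ →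
        (∀ g : X → ℝ, IsCompatibleProjection 𝒳 ℱ T P g →
          ∀ x y : X, g x = g y → f₁ x = f₁ y) →
        IsCompatibleProjection 𝒳 ℱ T P f₂ →
        (∀ g : X → ℝ, IsCompatibleProjection 𝒳 ℱ T P g →
          ∀ x y : X, g x = g y → f₂ x = f₂ y) →
        ∀ x y : X, f₁ x = f₁ y ↔ f₂ x = f₂ y := by
  refine ⟨?_, fun f₁ f₂ hf₁ h₁ hf₂ h₂ x y => ⟨h₂ f₁ hf₁ x y, h₁ f₂ hf₂ x y⟩⟩
  obtain ⟨f, hsep, hgen⟩ := (countable_refinement (T := T) (P := P)).exists_real_generator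
  have hle : sigmaOf f ≤ ℱ := by
    rw [hgen]
    exact MeasurableSpace.generateFrom_le fun A hA => measurableSet_of_mem_refinement hT
      (fun B hB q => hP.2 B hB measurableSet_Ioi) hA
  refine ⟨f, ⟨measurable_iff_comap_le.2 (hle.trans hℱ𝒳), ?_, hle, fun x y hxy F hF => ?_⟩,
    fun g ⟨hg, hTg, hgle, hgP⟩ x y hxy => ?_⟩
  · rw [hgen]
    exact MeasurableSpace.measurableSet_generateFrom self_mem_refinement
  · have := hP.1 x
    have := hP.1 y
    exact ext_on_measurableSpace_of_generate_finite ℱ (refinement T P)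
      (fun A hA => measure_eq_of_forall_mem_refinement_iff hP.1 ((hsep x y).1 hxy) hA) hle hgen
      (fun A hA B hB _ => inter_mem_refinement hA hB) (by simp only [measure_univ]) hF
  · refine (hsep x y).2 fun A hA => ?_
    obtain ⟨B, -, rfl⟩ := measurableSet_of_mem_refinement (m := sigmaOf g) hTg
      (fun B hB q => hBW g _ hg ((hP.2 B (hgle B hB)).mono hℱ𝒳 le_rfl)
        (fun x y h => congrArg ENNReal.toReal (hgP x y h B hB)) _
        ⟨Set.Ioi (q : ℝ), measurableSet_Ioi, rfl⟩) hA
    simp only [Set.mem_preimage, hxy]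
end

section
/- Let (X, ℱ, T, P) be a target problem on a measurable space (X, 𝒳) and let (ε_n)_{n≥1} and (ℱ_n)_{n≥0} be as in target-algorithm data (the measure μ and the kernels P_n are not needed). Then there exists a measurable function f : X → ℝ such that σ(f) = ⋁_n ℱ_n, such that for all x, y ∈ X, f(x) = f(y) if and only if x and y lie in the same cell of the ℱ_n-partition for every n, and such that: T ∈ σ(f); for every F ∈ σ(f) the map x ↦ P(x, F) is σ(f)-measurable; and P(x, F) = P(y, F) whenever f(x) = f(y) and F ∈ σ(f). In other words, the equivalence π_∞ = ⋂_n π_n is a compatible projection for (X, ℱ, T, P). -/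
open MeasureTheory Filter Topology

variable {X : Type*}

/-- Two finite measures on `ℕ` differ on any set by at most their `ℓ¹` distance. -/
theorem abs_measureReal_sub_le_tsum (μ ν : Measure ℕ) [IsFiniteMeasure μ] [IsFiniteMeasure ν]
    (B : Set ℕ) : |μ.real B - ν.real B| ≤ ∑' i, |μ.real {i} - ν.real {i}| := by
  have key (ρ : Measure ℕ) [IsFiniteMeasure ρ] (B : Set ℕ) :
      HasSum (B.indicator fun i => ρ.real {i}) (ρ.real B) := by
    have h := Measure.tsum_indicator_apply_singleton ρ B (.of_discrete)
    have hne (i : ℕ) : B.indicator (fun i => ρ {i}) i ≠ ⊤ :=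
      ((Set.indicator_le_self' (fun _ _ => zero_le) i).trans_lt (measure_lt_top ρ {i})).ne
    have hs : ∑' i, B.indicator (fun i => ρ {i}) i ≠ ⊤ := h ▸ measure_ne_top ρ B
    have h' := (ENNReal.summable_toReal hs).hasSum
    rw [← ENNReal.tsum_toReal_eq hne, h] at h'
    have hB : (B.indicator fun i => ρ.real {i}) =
        fun i => (B.indicator (fun i => ρ {i}) i).toReal := by
      ext i
      by_cases hi : i ∈ B <;> simp [hi, measureReal_def]
    rwa [hB]
  have hall (ρ : Measure ℕ) [IsFiniteMeasure ρ] : Summable fun i => ρ.real {i} := by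
    simpa using (key ρ Set.univ).summable
  have hd : Summable fun i => |μ.real {i} - ν.real {i}| := ((hall μ).sub (hall ν)).abs
  have hsub := (key μ B).sub (key ν B)
  have hle (i : ℕ) : ‖B.indicator (fun i => μ.real {i}) i - B.indicator (fun i => ν.real {i}) i‖
      ≤ |μ.real {i} - ν.real {i}| := by
    by_cases hi : i ∈ B <;> simp [hi]
  rw [← hsub.tsum_eq, ← Real.norm_eq_abs]
  exact tsum_of_norm_bounded hd.hasSum hle

/-- A function whose oscillation on the fibers of `c n` is at most `ε n`, with `ε n → 0`, is
measurable with respect to the σ-algebra generated by all `c n`. -/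
theorem measurable_of_fiber_oscillation_tendsto_zero {X : Type*} {m : MeasurableSpace X}
    {c : ℕ → X → ℕ} (hc : ∀ n, Measurable (c n)) {g : X → ℝ} {ε : ℕ → ℝ}
    (hε : Tendsto ε atTop (𝓝 0))
    (hg : ∀ᶠ n in atTop, ∀ x y, c n x = c n y → |g x - g y| ≤ ε n) : Measurable g := by
  refine measurable_of_tendsto_metrizable
    (f := fun n x => Function.extend (c n) g 0 (c n x))
    (fun n => (measurable_from_nat (f := Function.extend (c n) g 0)).comp (hc n)) ?_
  rw [tendsto_pi_nhds]
  intro x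
  rw [tendsto_iff_dist_tendsto_zero]
  refine squeeze_zero' (Eventually.of_forall fun _ => dist_nonneg) ?_ hε
  filter_upwards [hg] with n hn
  have hx : ∃ a, c n a = c n x := ⟨x, rfl⟩
  classical
  rw [Function.extend_def, dif_pos hx, Real.dist_eq]
  exact hn _ _ hx.choose_spec

/-- Measurability of `x ↦ P x F` extends from a generating π-system to the generated σ-algebra. -/
theorem measurable_measureReal_of_isPiSystem {X : Type*} {ℱ m : MeasurableSpace X} (hm : m ≤ ℱ)
    (P : X → @Measure X ℱ) (hP : ∀ x, IsProbabilityMeasure (P x)) {S : Set (Set X)}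
    (hS : m = MeasurableSpace.generateFrom S) (hpi : IsPiSystem S)
    (h : ∀ F ∈ S, Measurable[m] fun x => (P x F).toReal) {F : Set X}
    (hF : MeasurableSet[m] F) : Measurable[m] fun x => (P x F).toReal := by
  induction F, hF using MeasurableSpace.induction_on_inter hS hpi with
  | empty => simp
  | basic t ht => exact h t ht
  | compl t ht ih =>
    have (x : X) : (P x tᶜ).toReal = 1 - (P x t).toReal := by
      have := hP x
      exact probReal_compl_eq_one_sub (hm _ ht)
    simp only [this]
    exact measurable_const.sub ih
  | iUnion s hd hs ih =>
    have (x : X) : P x (⋃ i, s i) = ∑' i, ENNReal.ofReal (P x (s i)).toReal := by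
      have := hP x
      simp [measure_iUnion hd fun i => hm _ (hs i)]
    simp only [this]
    exact (Measurable.tsum fun i => (ih i).ennreal_ofReal).ennreal_toReal

theorem isPiSystem_iUnion_measurableSet {X : Type*} {m : ℕ → MeasurableSpace X}
    (hm : Monotone m) : IsPiSystem {s | ∃ n, MeasurableSet[m n] s} := by
  rintro s ⟨i, hs⟩ t ⟨j, ht⟩ -
  exact ⟨max i j, (hm (le_max_left i j) _ hs).inter (hm (le_max_right i j) _ ht)⟩

/-- A real function measurable with respect to `σ(f)` is constant on the fibers of `f`. -/
theorem eq_of_measurable_sigmaOf {X : Type*} {f g : X → ℝ} (hg : Measurable[sigmaOf f] g)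
    {x y : X} (hxy : f x = f y) : g x = g y := by
  obtain ⟨B, -, hB⟩ := hg (measurableSet_singleton (g x))
  have hx : x ∈ f ⁻¹' B := hB ▸ rfl
  have hy : y ∈ g ⁻¹' {g x} := hB ▸ (show f y ∈ B from hxy ▸ hx)
  exact hy.symm

/-- **Theorem (`π_∞ = ⋂_n π_n` is a compatible projection).**
Given a target problem `(X, ℱ, T, P)` and the sequences `(ε_n)`, `(ℱ_n)` of
target-algorithm data (with the cells of the `ℱ_n`-partition given by the fibers of
`c n`), there is a measurable `f : X → ℝ` with `σ(f) = ⋁_n ℱ_n`, whose level sets are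
exactly the intersections of the cells (`f x = f y ↔ ∀ n, c n x = c n y`), and which is a
compatible projection for `(X, ℱ, T, P)`: `T ∈ σ(f)`, `x ↦ P(x,F)` is `σ(f)`-measurable
for every `F ∈ σ(f)`, and `P(x,F) = P(y,F)` whenever `f x = f y` and `F ∈ σ(f)`. -/
theorem pi_infty_compatible_projection
    (𝒳 ℱ : MeasurableSpace X) (hℱ𝒳 : ℱ ≤ 𝒳)
    (T : Set X) (hT : MeasurableSet[ℱ] T)
    (P : X → @Measure X ℱ) (hP : IsTransProb ℱ P)
    (ε : ℕ → ℝ) (hεpos : ∀ n, 0 < ε n) (hεanti : StrictAnti ε)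
    (hεlim : Tendsto ε atTop (𝓝 0))
    (ℱn : ℕ → MeasurableSpace X) (c : ℕ → X → ℕ)
    (hmono : Monotone ℱn) (hle : ∀ n, ℱn n ≤ ℱ)
    (h0 : ℱn 0 = MeasurableSpace.generateFrom {T})
    (hgen : ∀ n, ℱn n = MeasurableSpace.comap (c n) ⊤)
    (happrox : ∀ (n : ℕ) (x y : X), c (n+1) x = c (n+1) y →
      (∑' i : ℕ, |((P x) (c n ⁻¹' {i})).toReal - ((P y) (c n ⁻¹' {i})).toReal|) ≤ ε (n+1)) :
    ∃ f : X → ℝ, Measurable[𝒳] f ∧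
      (sigmaOf f = ⨆ n, ℱn n) ∧
      (∀ x y : X, f x = f y ↔ ∀ n : ℕ, c n x = c n y) ∧
      MeasurableSet[sigmaOf f] T ∧
      (∀ F : Set X, MeasurableSet[sigmaOf f] F →
        Measurable[sigmaOf f] (fun x => ((P x) F).toReal)) ∧
      (∀ x y : X, f x = f y →
        ∀ F : Set X, MeasurableSet[sigmaOf f] F → (P x) F = (P y) F) := by
  have hprob := hP.1
  have hemb := measurableEmbedding_embeddingReal (ℕ → ℕ)
  let f : X → ℝ := fun x => embeddingReal (ℕ → ℕ) fun n => c n x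
  have hfib (x y : X) : f x = f y ↔ ∀ n, c n x = c n y :=
    hemb.injective.eq_iff.trans funext_iff
  have hσ : sigmaOf f = ⨆ n, ℱn n := by
    have hcomp : f = embeddingReal (ℕ → ℕ) ∘ fun x n => c n x := rfl
    rw [sigmaOf, hcomp, ← MeasurableSpace.comap_comp]
    erw [hemb.comap_eq]
    simp only [MeasurableSpace.pi, MeasurableSpace.comap_iSup, MeasurableSpace.comap_comp, hgen]
    rfl
  have hn (n : ℕ) : ℱn n ≤ sigmaOf f := hσ ▸ le_iSup ℱn n
  have hσℱ : sigmaOf f ≤ ℱ := hσ ▸ iSup_le hle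
  have hcσ (n : ℕ) : Measurable[sigmaOf f] (c n) :=
    measurable_iff_comap_le.2 (hgen n ▸ hn n)
  have hmeas : ∀ F, MeasurableSet[sigmaOf f] F →
      Measurable[sigmaOf f] fun x => (P x F).toReal := by
    intro F hF
    refine measurable_measureReal_of_isPiSystem hσℱ P hprob
      (hσ.trans (MeasurableSpace.measurableSpace_iSup_eq ℱn))
      (isPiSystem_iUnion_measurableSet hmono) ?_ hF
    rintro F ⟨n, hF⟩
    refine measurable_of_fiber_oscillation_tendsto_zero hcσ hεlim ?_
    filter_upwards [eventually_ge_atTop (n + 1)] with k hk x y hxy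
    obtain ⟨k, rfl⟩ : ∃ l, k = l + 1 := ⟨k - 1, by omega⟩
    have hF' := hmono (show n ≤ k by omega) F hF
    rw [hgen k] at hF'
    obtain ⟨B, -, rfl⟩ := hF'
    refine le_trans ?_ (happrox k x y hxy)
    have hck : Measurable[ℱ] (c k) := (hcσ k).mono hσℱ le_rfl
    have hmap (z : X) (C : Set ℕ) : ((P z).map (c k)).real C = (P z (c k ⁻¹' C)).toReal := by
      rw [measureReal_def, Measure.map_apply hck (.of_discrete)]
    have := hprob x
    have := hprob y
    simpa only [hmap] using abs_measureReal_sub_le_tsum ((P x).map (c k)) ((P y).map (c k)) B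
  refine ⟨f, measurable_iff_comap_le.2 (hσℱ.trans hℱ𝒳), hσ, hfib, ?_, hmeas, ?_⟩
  · exact hn 0 T (h0 ▸ MeasurableSpace.measurableSet_generateFrom rfl)
  · intro x y hxy F hF
    have := hprob x
    have := hprob y
    exact (ENNReal.toReal_eq_toReal_iff' (measure_ne_top _ _) (measure_ne_top _ _)).1
      (eq_of_measurable_sigmaOf (hmeas F hF) hxy)
end

section
/- Let (X, ℱ, T, P) be a target problem on a measurable space (X, 𝒳) with target-algorithm data ((ε_n), (ℱ_n), μ, (P_n)). Fix x ∈ X. For each n let ν_n be any probability measure on ⋁_m ℱ_m such that ν_n(F) = P_n(x, F) for all F ∈ ℱ_n. Then for every set C of the form C = ⋂_n C_n with C_n ∈ ℱ_n for each n, one has limsup_{n→∞} ν_n(C) ≤ P(x, C). -/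
open MeasureTheory Filter Topology

variable {X : Type*}

/-- The measures of a preimage under a map to `ℕ` differ by at most the `ℓ¹` distance of the
two families of fibre measures. -/
theorem measureReal_preimage_le_add_tsum {X : Type*} {m : MeasurableSpace X} (p q : Measure X)
    [IsFiniteMeasure p] [IsFiniteMeasure q] {c : X → ℕ} (hc : Measurable c) (S : Set ℕ) :
    (p (c ⁻¹' S)).toReal ≤ (q (c ⁻¹' S)).toReal +
      ∑' i : ℕ, |(p (c ⁻¹' {i})).toReal - (q (c ⁻¹' {i})).toReal| := by
  have sum_fibres (r : Measure X) [IsFiniteMeasure r] (U : Set ℕ) :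
      ∑' i : U, r (c ⁻¹' {(i : ℕ)}) = r (c ⁻¹' U) :=
    tsum_measure_preimage_singleton U.to_countable fun i _ => hc (measurableSet_singleton i)
  have sum_toReal (r : Measure X) [IsFiniteMeasure r] (U : Set ℕ) :
      HasSum (fun i : U => (r (c ⁻¹' {(i : ℕ)})).toReal) (r (c ⁻¹' U)).toReal := by
    rw [← sum_fibres r U, ENNReal.tsum_toReal_eq fun _ => measure_ne_top _ _]
    exact ENNReal.hasSum_toReal ((sum_fibres r U).trans_ne (measure_ne_top _ _))
  have summable_fibres (r : Measure X) [IsFiniteMeasure r] :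
      Summable fun i : ℕ => (r (c ⁻¹' {i})).toReal :=
    ENNReal.summable_toReal (by
      rw [← tsum_univ fun i : ℕ => r (c ⁻¹' {i}), sum_fibres r]; exact measure_ne_top _ _)
  have hdiff := ((summable_fibres p).sub (summable_fibres q)).abs
  have hsub := ((sum_toReal p S).sub (sum_toReal q S)).tsum_eq
  have h : (p (c ⁻¹' S)).toReal - (q (c ⁻¹' S)).toReal ≤
      ∑' i : ℕ, |(p (c ⁻¹' {i})).toReal - (q (c ⁻¹' {i})).toReal| := by
    rw [← hsub]
    refine le_trans ?_ (hdiff.tsum_subtype_le _ S fun _ => abs_nonneg _)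
    exact ((sum_toReal p S).sub (sum_toReal q S)).summable.tsum_le_tsum
      (fun _ => le_abs_self _) (hdiff.subtype S)
  linarith

/-- A function bounded above on `A` by a nonnegative constant has its average over `A` bounded by
that constant, without any integrability assumption. -/
theorem setIntegral_div_measure_le_of_forall_le {X : Type*} {m : MeasurableSpace X}
    (μ : Measure X) [IsFiniteMeasure μ] {A : Set X} (hA : MeasurableSet A)
    {f : X → ℝ} (hf : ∀ z, 0 ≤ f z) {b : ℝ} (hb : 0 ≤ b) (hfb : ∀ z ∈ A, f z ≤ b) :
    (∫ z in A, f z ∂μ) / (μ A).toReal ≤ b := by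
  refine div_le_of_le_mul₀ ENNReal.toReal_nonneg hb ?_
  calc ∫ z in A, f z ∂μ ≤ ∫ _ in A, b ∂μ :=
        integral_mono_of_nonneg (ae_of_all _ hf) (integrable_const b)
          (ae_restrict_of_forall_mem hA hfb)
    _ = b * (μ A).toReal := by simp [Measure.real, mul_comm]

/-- **Theorem (limsup bound on closed sets).**
Given a target problem `(X, ℱ, T, P)` with target-algorithm data, a point `x`, and for
each `n` any probability measure `ν_n` on `⋁_m ℱ_m` extending `P_n(x,·)` from `ℱ_n`,
one has `limsup_n ν_n(C) ≤ P(x,C)` for every set `C = ⋂_n C_n` with `C_n ∈ ℱ_n`. -/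
theorem limsup_extension_le
    (𝒳 ℱ : MeasurableSpace X) (hℱ𝒳 : ℱ ≤ 𝒳)
    (T : Set X) (hT : MeasurableSet[ℱ] T)
    (P : X → @Measure X ℱ) (hP : IsTransProb ℱ P)
    -- target-algorithm data
    (ε : ℕ → ℝ) (hεpos : ∀ n, 0 < ε n) (hεanti : StrictAnti ε)
    (hεlim : Tendsto ε atTop (𝓝 0))
    (ℱn : ℕ → MeasurableSpace X) (c : ℕ → X → ℕ)
    (hmono : Monotone ℱn) (hle : ∀ n, ℱn n ≤ ℱ)
    (h0 : ℱn 0 = MeasurableSpace.generateFrom {T})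
    (hgen : ∀ n, ℱn n = MeasurableSpace.comap (c n) ⊤)
    (happrox : ∀ (n : ℕ) (x y : X), c (n+1) x = c (n+1) y →
      (∑' i : ℕ, |((P x) (c n ⁻¹' {i})).toReal - ((P y) (c n ⁻¹' {i})).toReal|) ≤ ε (n+1))
    (μ : @Measure X (⨆ n, ℱn n)) (hμ : IsProbabilityMeasure μ)
    (hμpos : ∀ (n : ℕ) (F : Set X), MeasurableSet[ℱn n] F → F.Nonempty → 0 < μ F)
    (Pn : ∀ n : ℕ, X → @Measure X (ℱn n))
    (hPn : ∀ n, IsTransProb (ℱn n) (Pn n))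
    (hPndef : ∀ (n : ℕ) (x : X) (F : Set X), MeasurableSet[ℱn n] F →
      ((Pn n x) F).toReal =
        (∫ z in c n ⁻¹' {c n x}, ((P z) F).toReal ∂μ) / (μ (c n ⁻¹' {c n x})).toReal)
    -- a fixed point x and arbitrary extensions ν_n of P_n(x,·) to ⋁_m ℱ_m
    (x : X)
    (ν : ℕ → @Measure X (⨆ m, ℱn m)) (hν : ∀ n, IsProbabilityMeasure (ν n))
    (hext : ∀ (n : ℕ) (F : Set X), MeasurableSet[ℱn n] F → (ν n) F = (Pn n x) F)
    -- a "closed" set C = ⋂_n C_n with C_n ∈ ℱ_n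
    (C : Set X) (Cs : ℕ → Set X) (hCs : ∀ n, MeasurableSet[ℱn n] (Cs n))
    (hC : C = ⋂ n, Cs n) :
    Filter.limsup (fun n => (ν n) C) atTop ≤ (P x) C := by
  have hPx := hP.1
  have cells (n : ℕ) : Measurable[ℱ] (c n) :=
    Measurable.mono (comap_measurable (c n)) (hgen n ▸ hle n) le_rfl
  have bound (n : ℕ) (F : Set X) (hF : MeasurableSet[ℱn n] F) :
      ν (n + 1) F ≤ P x F + ENNReal.ofReal (ε (n + 1)) := by
    have hF' := hmono n.le_succ F hF
    obtain ⟨S, -, rfl⟩ : ∃ S : Set ℕ, MeasurableSet S ∧ c n ⁻¹' S = F := by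
      rwa [hgen n] at hF
    have hprob := (hPn (n + 1)).1 x
    have hcell : MeasurableSet[⨆ m, ℱn m] (c (n + 1) ⁻¹' {c (n + 1) x}) := by
      refine le_iSup ℱn (n + 1) _ ?_
      rw [hgen (n + 1)]
      exact ⟨_, trivial, rfl⟩
    have hreal : ((Pn (n + 1) x) (c n ⁻¹' S)).toReal ≤ (P x (c n ⁻¹' S)).toReal + ε (n + 1) := by
      rw [hPndef (n + 1) x _ hF']
      refine setIntegral_div_measure_le_of_forall_le μ hcell (fun _ => ENNReal.toReal_nonneg)
        (add_nonneg ENNReal.toReal_nonneg (hεpos _).le) fun z hz => ?_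
      exact (measureReal_preimage_le_add_tsum (P z) (P x) (cells n) S).trans
        (by gcongr; exact happrox n z x hz)
    rw [hext _ _ hF', ← ENNReal.ofReal_toReal (measure_ne_top (Pn (n + 1) x) (c n ⁻¹' S)),
      ← ENNReal.ofReal_toReal (measure_ne_top (P x) (c n ⁻¹' S)),
      ← ENNReal.ofReal_add ENNReal.toReal_nonneg (hεpos _).le]
    exact ENNReal.ofReal_le_ofReal hreal
  have hD (m : ℕ) : MeasurableSet[ℱn m] (⋂ k ≤ m, Cs k) :=
    MeasurableSet.iInter fun k => MeasurableSet.iInter fun hk => hmono hk _ (hCs k)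
  have limsup_le (m : ℕ) : limsup (fun n => (ν n) C) atTop ≤ P x (⋂ k ≤ m, Cs k) := by
    rw [← limsup_nat_add _ 1]
    have hlim : Tendsto (fun n => P x (⋂ k ≤ m, Cs k) + ENNReal.ofReal (ε (n + 1))) atTop
        (𝓝 (P x (⋂ k ≤ m, Cs k))) := by
      have h := ENNReal.tendsto_ofReal ((tendsto_add_atTop_iff_nat 1).2 hεlim)
      simpa using h.const_add (P x (⋂ k ≤ m, Cs k))
    rw [← hlim.limsup_eq]
    refine limsup_le_limsup ?_
    filter_upwards [eventually_ge_atTop m] with n hn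
    refine (measure_mono ?_).trans (bound n _ (hmono hn _ (hD m)))
    rw [hC]
    exact fun y hy => Set.mem_iInter₂.2 fun k _ => Set.mem_iInter.1 hy k
  have hCD : C = ⋂ m, ⋂ k ≤ m, Cs k := by
    rw [hC]
    ext y
    simp only [Set.mem_iInter]
    exact ⟨fun h _ k _ => h k, fun h k => h k k le_rfl⟩
  have htend : Tendsto (fun m => P x (⋂ k ≤ m, Cs k)) atTop (𝓝 (P x C)) := by
    rw [hCD]
    exact tendsto_measure_iInter_atTop (fun m => (hle m _ (hD m)).nullMeasurableSet)
      (fun _ _ hab => Set.biInter_subset_biInter_left fun _ hk => le_trans hk hab)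
      ⟨0, measure_ne_top _ _⟩
  exact ge_of_tendsto' htend limsup_le
end

section
/- Let X be a set and f, g : X → ℝ functions such that for all x, y ∈ X, g(x) < g(y) implies f(x) < f(y). Then σ(g) ⊆ σ(f), i.e., every set of the form g⁻¹(B) with B ⊆ ℝ Borel is also of the form f⁻¹(B') for some Borel B' ⊆ ℝ. -/
open MeasureTheory

/-- **Lemma.** If `f, g : X → ℝ` satisfy `g x < g y → f x < f y`, then `σ(g) ⊆ σ(f)`. -/
theorem sigma_le_of_strict_mono_compat {X : Type*} (f g : X → ℝ)
    (h : ∀ x y : X, g x < g y → f x < f y) :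
    sigmaOf g ≤ sigmaOf f := by
  refine Measurable.comap_le (measurable_of_Ioi fun c => ?_)
  refine ⟨upperClosure (f '' (g ⁻¹' Set.Ioi c)),
    (upperClosure _).upper.ordConnected.measurableSet, ?_⟩
  ext y
  constructor
  · rintro ⟨_, ⟨x, hx, rfl⟩, hxy⟩
    exact lt_of_lt_of_le hx (not_lt.1 fun hlt => (h y x hlt).not_ge hxy)
  · exact fun hy => ⟨f y, ⟨y, hy, rfl⟩, le_rfl⟩
end

section
/- Let (X, 𝒳) be a measurable space and, for each n ∈ ℕ, let f_n : X → ℝ be a measurable function with countable range. Then there exists a measurable function f : X → ℝ such that σ(f) = ⋁_n σ(f_n). (Equivalently: for any sequence of countable measurable partitions of X, there is a single real random variable generating the join of the generated σ-algebras.) -/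
open MeasureTheory

/-- **Lemma.** For every sequence `(f_n)` of measurable real functions with countable
range on `(X,𝒳)` there is a single measurable `f : X → ℝ` with
`σ(f) = ⋁_n σ(f_n)`. -/
theorem exists_generator_of_join {X : Type*}
    (𝒳 : MeasurableSpace X) (f : ℕ → X → ℝ)
    (hmeas : ∀ n, Measurable[𝒳] (f n))
    (hcount : ∀ n, (Set.range (f n)).Countable) :
    ∃ g : X → ℝ, Measurable[𝒳] g ∧ sigmaOf g = ⨆ n, sigmaOf (f n) := by
  have hemb := measurableEmbedding_embeddingReal (ℕ → ℝ)
  refine ⟨embeddingReal (ℕ → ℝ) ∘ fun x n => f n x,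
    hemb.measurable.comp (measurable_pi_iff.mpr hmeas), ?_⟩
  unfold sigmaOf
  rw [← MeasurableSpace.comap_comp, hemb.comap_eq, MeasurableSpace.comap_process_pi]
end

section
/- Let (X, 𝒳) be a measurable space. Then every equivalence relation π on X is measurable (i.e., for every equivalence relation π there exists a measurable f : X → ℝ with x π y ⟺ f(x) = f(y)) if and only if 𝒳 = 2^X (every subset of X is measurable) and the cardinality of X is at most the cardinality of ℝ. (The 'if' direction uses the axiom of choice.) -/
open MeasureTheory

/-- **Lemma.** On a measurable space `(X,𝒳)`, every equivalence relation is measurable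
(induced by a measurable real function) if and only if `𝒳 = 2^X` and
`card X ≤ card ℝ`. (The "if" direction uses the axiom of choice.) -/
theorem every_equiv_measurable_iff {X : Type*} (𝒳 : MeasurableSpace X) :
    (∀ π : X → X → Prop, Equivalence π →
        ∃ f : X → ℝ, Measurable[𝒳] f ∧ ∀ x y : X, π x y ↔ f x = f y) ↔
      (𝒳 = ⊤ ∧ Cardinal.mk X ≤ Cardinal.continuum) := by
  constructor
  · intro h
    constructor
    · refine eq_top_iff.2 fun A _ => ?_
      obtain ⟨f, hf, hfA⟩ := h (fun x y => x ∈ A ↔ y ∈ A)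
        ⟨fun _ => Iff.rfl, Iff.symm, Iff.trans⟩
      rcases A.eq_empty_or_nonempty with rfl | ⟨a, ha⟩
      · exact MeasurableSet.empty
      · have hA : A = f ⁻¹' {f a} := by
          ext x
          simp [← hfA, ha]
        rw [hA]
        exact hf (measurableSet_singleton _)
    · obtain ⟨f, -, hf⟩ := h Eq eq_equivalence
      have hinj : Function.Injective f := fun x y => (hf x y).2
      simpa [Cardinal.mk_real] using Cardinal.lift_mk_le_lift_mk_of_injective hinj
  · rintro ⟨rfl, hX⟩ π hπ
    obtain ⟨g⟩ : Nonempty (X ↪ ℝ) := by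
      rw [← Cardinal.lift_mk_le']
      simpa [Cardinal.mk_real] using hX
    let s : Setoid X := ⟨π, hπ⟩
    refine ⟨fun x => g (Quotient.mk s x).out, measurable_from_top, fun x y => ?_⟩
    rw [g.injective.eq_iff, Quotient.out_inj, Quotient.eq]
    rfl
end
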